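/- Let T, T' be triangulations of C(m,2d) such that T <₂ T' (i.e. T ≤₂ T' and T ≠ T'), and suppose that T[1→2] = T'[1→2] and T[m−1←m] = T'[m−1←m]. Then simp(T) ∖ simp(T') is nonempty and every A = (a_0,…,a_d) ∈ simp(T) ∖ simp(T') satisfies a_0 = 1 and a_d = m−1; dually, simp(T') ∖ simp(T) is nonempty and every B = (b_0,…,b_d) ∈ simp(T') ∖ simp(T) satisfies b_0 = 2 and b_d = m. -/

import Mathlib

open scoped Classical

namespace HST

/-- `AltChain l₁ l₂` holds when the alternating merge of the two lists, starting with the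
head of `l₁`, is strictly increasing: `a₀ < b₀ < a₁ < b₁ < ⋯`.  The lengths must satisfy
`l₂.length ≤ l₁.length ≤ l₂.length + 1`. -/
def AltChain : List ℚ → List ℚ → Prop
  | [], [] => True
  | [], _ :: _ => False
  | [_], [] => True
  | _ :: _ :: _, [] => False
  | a :: as, b :: bs => a < b ∧ AltChain (b :: bs) as
termination_by l₁ l₂ => l₁.length + l₂.length
decreasing_by simp; omega

/-- The alternating merge starting with the least element of `A`. -/
def Intertwines (A B : Finset ℚ) : Prop :=
  AltChain (A.sort (· ≤ ·)) (B.sort (· ≤ ·))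

/-- The paper's intertwining relation `A ≀ B`: for `#A = #B = k + 1` it means
`a₀ < b₀ < a₁ < b₁ < ⋯ < a_k < b_k`; for `#A = #B - 1` it means
`b₀ < a₀ < b₁ < a₁ < ⋯ < b_k`. -/
def Wr (A B : Finset ℚ) : Prop :=
  if A.card = B.card then Intertwines A B else Intertwines B A

/-- Gale's evenness criterion: upper facets of the cyclic polytope with vertex set `V`. -/
def IsUpperFacet (V : Finset ℚ) (n : ℕ) (F : Finset ℚ) : Prop :=
  F ⊆ V ∧ F.card = n ∧ ∀ w ∈ V \ F, Odd ((F.filter fun x => w < x).card)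

/-- Gale's evenness criterion: lower facets of the cyclic polytope with vertex set `V`. -/
def IsLowerFacet (V : Finset ℚ) (n : ℕ) (F : Finset ℚ) : Prop :=
  F ⊆ V ∧ F.card = n ∧ ∀ w ∈ V \ F, Even ((F.filter fun x => w < x).card)

def IsFacet (V : Finset ℚ) (n : ℕ) (F : Finset ℚ) : Prop :=
  IsUpperFacet V n F ∨ IsLowerFacet V n F

/-- The circuits of the cyclic polytope `C(V, n)`. -/
def IsCircuit (V : Finset ℚ) (n : ℕ) (Zp Zm : Finset ℚ) : Prop :=
  Zp ⊆ V ∧ Zm ⊆ V ∧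
    ((Zp.card = n / 2 + 1 ∧ Zm.card = (n + 1) / 2 + 1 ∧ Wr Zp Zm) ∨
      (Zm.card = n / 2 + 1 ∧ Zp.card = (n + 1) / 2 + 1 ∧ Wr Zm Zp))

/-- Combinatorial triangulations of the cyclic polytope `C(V, n)`. -/
def IsTriangulation (V : Finset ℚ) (n : ℕ) (T : Finset (Finset ℚ)) : Prop :=
  (∀ S ∈ T, S ⊆ V ∧ S.card = n + 1) ∧
    (∀ S ∈ T, ∀ F ⊆ S, F.card = n →
      (∃ G, IsFacet V n G ∧ F ⊆ G) ∨ ∃ R ∈ T, R ≠ S ∧ F ⊆ R) ∧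
    (∀ S ∈ T, ∀ R ∈ T, ∀ Zp Zm, IsCircuit V n Zp Zm → ¬(Zp ⊆ S ∧ Zm ⊆ R))

noncomputable def lowerFacets (V : Finset ℚ) (n : ℕ) : Finset (Finset ℚ) :=
  V.powerset.filter fun F => IsLowerFacet V n F

noncomputable def upperFacets (V : Finset ℚ) (n : ℕ) : Finset (Finset ℚ) :=
  V.powerset.filter fun F => IsUpperFacet V n F

/-- `T'` is an increasing bistellar flip of `T`. -/
def IsIncFlip (V : Finset ℚ) (n : ℕ) (T T' : Finset (Finset ℚ)) : Prop :=
  ∃ U, U ⊆ V ∧ U.card = n + 2 ∧ lowerFacets U (n + 1) ⊆ T ∧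
    T' = (T \ lowerFacets U (n + 1)) ∪ upperFacets U (n + 1)

/-- The first higher Stasheff–Tamari order. -/
def Le1 (V : Finset ℚ) (n : ℕ) : Finset (Finset ℚ) → Finset (Finset ℚ) → Prop :=
  Relation.ReflTransGen (IsIncFlip V n)

/-- `simp(T)`: the internal `⌊n/2⌋`-simplices of a triangulation `T` of `C(V, n)`. -/
noncomputable def internalSimps (V : Finset ℚ) (n : ℕ) (T : Finset (Finset ℚ)) :
    Finset (Finset ℚ) :=
  V.powerset.filter fun A =>
    A.card = n / 2 + 1 ∧ (∃ S ∈ T, A ⊆ S) ∧ ∀ F, IsFacet V n F → ¬A ⊆ F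

/-- The second higher Stasheff–Tamari order in even dimension `n = 2d`. -/
def Le2Even (V : Finset ℚ) (d : ℕ) (T T' : Finset (Finset ℚ)) : Prop :=
  ∀ A ∈ internalSimps V (2 * d) T, ∀ B ∈ internalSimps V (2 * d) T', ¬Wr B A

/-- The second higher Stasheff–Tamari order in odd dimension `n = 2d + 1`. -/
def Le2Odd (V : Finset ℚ) (d : ℕ) (T T' : Finset (Finset ℚ)) : Prop :=
  internalSimps V (2 * d + 1) T' ⊆ internalSimps V (2 * d + 1) T

/-- The second higher Stasheff–Tamari order. -/
def Le2 (V : Finset ℚ) (n : ℕ) (T T' : Finset (Finset ℚ)) : Prop :=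
  if Even n then ∀ A ∈ internalSimps V n T, ∀ B ∈ internalSimps V n T', ¬Wr B A
  else internalSimps V n T' ⊆ internalSimps V n T

/-- The vertex set `[m] = {1, …, m}`, realised inside `ℚ`. -/
noncomputable def vSet (m : ℕ) : Finset ℚ := (Finset.Icc 1 m).image fun i => (i : ℚ)

/-- `C(U, n)` is a subpolytope of the triangulation `T`. -/
def IsSubpolytope (n : ℕ) (T : Finset (Finset ℚ)) (U : Finset ℚ) : Prop :=
  IsTriangulation U n (T.filter fun S => S ⊆ U)

/-- Contraction of a triangulation along a vertex map `c`. -/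
noncomputable def contractTri (c : ℚ → ℚ) (n : ℕ) (T : Finset (Finset ℚ)) :
    Finset (Finset ℚ) :=
  (T.image fun S => S.image c).filter fun S => S.card = n + 1

/-- The vertex map of the contraction `[m - 1 ← m]`. -/
def topMap (m : ℚ) (a : ℚ) : ℚ := if a = m then m - 1 else a

/-- The vertex map of the contraction `[1 → 2]`. -/
def botMap (a : ℚ) : ℚ := if a = 1 then 2 else a

/-- The vertex `x` of `[N]_{v+}`, realised in `ℚ`. -/
def xOf (v : ℕ) : ℚ := (v : ℚ) - 1/3

/-- The vertex `y` of `[N]_{v+}`, realised in `ℚ`. -/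
def yOf (v : ℕ) : ℚ := (v : ℚ) + 1/3

/-- The vertex set `[N]_{v+} = {1, …, v - 1, x, y, v + 1, …, N}`. -/
noncomputable def vPlus (N v : ℕ) : Finset ℚ :=
  insert (xOf v) (insert (yOf v) ((vSet N).erase (v : ℚ)))

/-- The vertex map of the contraction `[x → v ← y]`. -/
def midMap (v : ℕ) (a : ℚ) : ℚ := if a = xOf v ∨ a = yOf v then (v : ℚ) else a

/-- `U_{v+}` for a subset `U` of `[N]`. -/
noncomputable def setVPlus (v : ℕ) (U : Finset ℚ) : Finset ℚ :=
  if (v : ℚ) ∈ U then insert (xOf v) (insert (yOf v) (U.erase (v : ℚ))) else U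

/-- `I(m, d)`: the internal `d`-simplices of `C(m, 2d)`. -/
noncomputable def Iset (m d : ℕ) : Finset (Finset ℚ) :=
  (vSet m).powerset.filter fun A =>
    A.card = d + 1 ∧ (∀ a ∈ A, a + 1 ∉ A) ∧ ¬((1 : ℚ) ∈ A ∧ (m : ℚ) ∈ A)

/-- `O(m, d)`: the internal `d`-simplices of `C(m, 2d + 1)`. -/
noncomputable def Oset (m d : ℕ) : Finset (Finset ℚ) :=
  (Iset m d).filter fun A => (1 : ℚ) ∉ A ∧ (m : ℚ) ∉ A


/-- The number of elements of `U` above `z`. -/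
noncomputable def up (U : Finset ℚ) (z : ℚ) : ℕ := (U.filter fun x => z < x).card

/-- The number of elements of `F` strictly between `a` and `v`. -/
noncomputable def btw (F : Finset ℚ) (a v : ℚ) : ℕ :=
  (F.filter fun z => (a < z ∧ z < v) ∨ (v < z ∧ z < a)).card

/-- There is an `(n + 2)`-set whose elements, read downwards, lie alternately in `P` and in `Q`. -/
def Cross (n : ℕ) (P Q : Finset ℚ) : Prop :=
  ∃ U : Finset ℚ, U.card = n + 2 ∧
    ∀ z ∈ U, (Even (up U z) → z ∈ P) ∧ (¬Even (up U z) → z ∈ Q)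

lemma Cross.mono {n : ℕ} {P Q P' Q' : Finset ℚ} (h : Cross n P Q) (hP : P ⊆ P') (hQ : Q ⊆ Q') :
    Cross n P' Q' := by
  obtain ⟨U, hU, h⟩ := h
  exact ⟨U, hU, fun z hz => ⟨fun e => hP ((h z hz).1 e), fun e => hQ ((h z hz).2 e)⟩⟩

lemma up_insert_of_lt {F : Finset ℚ} {x z : ℚ} (hx : x ∉ F) (h : z < x) :
    up (insert x F) z = up F z + 1 := by
  unfold up
  rw [Finset.filter_insert, if_pos h, Finset.card_insert_of_notMem (by simp [hx])]

lemma up_insert_of_le {F : Finset ℚ} {x z : ℚ} (h : x ≤ z) : up (insert x F) z = up F z := by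
  unfold up
  rw [Finset.filter_insert, if_neg (not_lt.mpr h)]

lemma btw_comm (F : Finset ℚ) (a v : ℚ) : btw F a v = btw F v a := by
  unfold btw
  congr 1
  ext z
  simp only [Finset.mem_filter]
  tauto

lemma btw_insert {F : Finset ℚ} {x a v : ℚ} (h : ¬((a < x ∧ x < v) ∨ (v < x ∧ x < a))) :
    btw (insert x F) a v = btw F a v := by
  unfold btw
  rw [Finset.filter_insert, if_neg h]

lemma up_eq_btw_add_up {F : Finset ℚ} {a v : ℚ} (hv : v ∉ F) (h : a ≤ v) :
    up F a = btw F a v + up F v := by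
  unfold up btw
  rw [← Finset.card_union_of_disjoint]
  · congr 1
    ext z
    simp only [Finset.mem_filter, Finset.mem_union]
    constructor
    · rintro ⟨hz, haz⟩
      rcases lt_trichotomy z v with h' | h' | h'
      · exact Or.inl ⟨hz, Or.inl ⟨haz, h'⟩⟩
      · exact absurd (h' ▸ hz) hv
      · exact Or.inr ⟨hz, h'⟩
    · rintro (⟨hz, h' | h'⟩ | ⟨hz, h'⟩)
      · exact ⟨hz, h'.1⟩
      · exact ⟨hz, by linarith⟩
      · exact ⟨hz, by linarith⟩
  · rw [Finset.disjoint_left]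
    intro z hz hz'
    simp only [Finset.mem_filter] at hz hz'
    rcases hz.2 with h' | h' <;> linarith [h'.1, h'.2, hz'.2]

lemma even_btw_iff {F : Finset ℚ} {a v : ℚ} (ha : a ∉ F) (hv : v ∉ F) :
    Even (btw F a v) ↔ (Even (up F a) ↔ Even (up F v)) := by
  rcases le_total a v with h | h
  · rw [up_eq_btw_add_up hv h, Nat.even_add]
    tauto
  · rw [up_eq_btw_add_up ha h, btw_comm F v a, Nat.even_add]
    tauto

lemma even_up_insert_insert {F : Finset ℚ} {x y : ℚ} (hx : x ∉ F) (hy : y ∉ F) (hxy : x ≠ y) :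
    (Even (up (insert x (insert y F)) x) ↔ Even (up (insert x (insert y F)) y)) ↔
      ¬(Even (up F x) ↔ Even (up F y)) := by
  rcases lt_or_gt_of_ne hxy with h | h
  · rw [up_insert_of_le le_rfl, up_insert_of_lt hy h, up_insert_of_le h.le,
      up_insert_of_le le_rfl, Nat.even_add_one]
    tauto
  · rw [up_insert_of_le le_rfl, up_insert_of_le h.le, Finset.insert_comm,
      up_insert_of_le le_rfl, up_insert_of_lt hx h, Nat.even_add_one]
    tauto

lemma cross_of_same_side {n : ℕ} {F : Finset ℚ} {x y : ℚ} (hF : F.card = n) (hx : x ∉ F)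
    (hy : y ∉ F) (hxy : x ≠ y) (h : Even (up F x) ↔ Even (up F y)) :
    Cross n (insert x F) (insert y F) ∨ Cross n (insert y F) (insert x F) := by
  have hpar := (not_congr (even_up_insert_insert hx hy hxy)).mpr (not_not.mpr h)
  have hcard : (insert x (insert y F)).card = n + 2 := by
    rw [Finset.card_insert_of_notMem (by simp [hxy, hx]), Finset.card_insert_of_notMem hy, hF]
  by_cases hex : Even (up (insert x (insert y F)) x)
  · left
    refine ⟨_, hcard, fun z hz => ?_⟩
    rcases Finset.mem_insert.mp hz with rfl | hz
    · exact ⟨by simp, fun h => absurd hex h⟩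
    rcases Finset.mem_insert.mp hz with rfl | hz
    · exact ⟨fun h => absurd (iff_of_true hex h) hpar, by simp⟩
    · simp [hz]
  · right
    refine ⟨_, hcard, fun z hz => ?_⟩
    rcases Finset.mem_insert.mp hz with rfl | hz
    · exact ⟨fun h => absurd h hex, by simp⟩
    rcases Finset.mem_insert.mp hz with rfl | hz
    · exact ⟨by simp, fun h => absurd (iff_of_false hex h) hpar⟩
    · simp [hz]

lemma IsFacet.even_up_iff {V F : Finset ℚ} {n : ℕ} (h : IsFacet V n F) {x y : ℚ} (hxV : x ∈ V)
    (hyV : y ∈ V) (hx : x ∉ F) (hy : y ∉ F) : Even (up F x) ↔ Even (up F y) := by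
  rcases h with h | h
  · have h1 := h.2.2 x (by simp [hxV, hx])
    have h2 := h.2.2 y (by simp [hyV, hy])
    rw [← Nat.not_even_iff_odd] at h1 h2
    exact iff_of_false h1 h2
  · exact iff_of_true (h.2.2 x (by simp [hxV, hx])) (h.2.2 y (by simp [hyV, hy]))

lemma IsFacet.card_eq {V F : Finset ℚ} {n : ℕ} (h : IsFacet V n F) : F.card = n :=
  h.elim (fun h => h.2.1) (fun h => h.2.1)

/-- The position of `v` in `S` as seen from `a`: `1` if an even number of elements of `S` separate
`v ∈ S` from `a`, `-1` if an odd number do, and `0` if `v ∉ S`. -/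
noncomputable def viewSign (a : ℚ) (S : Finset ℚ) (v : ℚ) : ℤ :=
  if v ∈ S then (if Even (btw S a v) then 1 else -1) else 0

/-- The signs of the elements of `S` as seen from `a`, compared lexicographically by distance. -/
noncomputable def viewKey (a : ℚ) (S : Finset ℚ) : Lex (ℚ → ℤ) :=
  toLex fun q => if q < 0 then 0 else viewSign a S (a - q) + viewSign a S (a + q)

lemma viewSign_bounds (a : ℚ) (S : Finset ℚ) (v : ℚ) : -1 ≤ viewSign a S v ∧ viewSign a S v ≤ 1 := by
  unfold viewSign
  split_ifs <;> simp

lemma not_between_of_abs_le {a x v : ℚ} (h : |v - a| ≤ |x - a|) :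
    ¬((a < x ∧ x < v) ∨ (v < x ∧ x < a)) := by
  rintro (⟨h1, h2⟩ | ⟨h1, h2⟩)
  · rw [abs_of_pos (by linarith), abs_of_pos (by linarith)] at h
    linarith
  · rw [abs_of_neg (by linarith), abs_of_neg (by linarith)] at h
    linarith

lemma viewKey_lt {a x y : ℚ} {F : Finset ℚ} (hx : x ∉ F) (hy : y ∉ F) (hxy : x ≠ y)
    (hox : ¬Even (btw F a x)) (hey : Even (btw F a y)) :
    viewKey a (insert x F) < viewKey a (insert y F) := by
  have sx : viewSign a (insert x F) x = -1 := by
    simp [viewSign, btw_insert (not_between_of_abs_le le_rfl), hox]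
  have sy : viewSign a (insert y F) y = 1 := by
    simp [viewSign, btw_insert (not_between_of_abs_le le_rfl), hey]
  have sx' : viewSign a (insert y F) x = 0 := by simp [viewSign, hx, hxy]
  have sy' : viewSign a (insert x F) y = 0 := by simp [viewSign, hy, hxy.symm]
  have same : ∀ v, |v - a| ≤ |x - a| → |v - a| ≤ |y - a| → v ≠ x → v ≠ y →
      viewSign a (insert x F) v = viewSign a (insert y F) v := by
    intro v h1 h2 hvx hvy
    simp [viewSign, btw_insert (not_between_of_abs_le h1), btw_insert (not_between_of_abs_le h2),
      hvx, hvy]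
  have mono : ∀ v, |v - a| ≤ |x - a| → |v - a| ≤ |y - a| →
      viewSign a (insert x F) v ≤ viewSign a (insert y F) v := by
    intro v h1 h2
    by_cases hvx : v = x
    · rw [hvx, sx]; exact (viewSign_bounds _ _ _).1
    by_cases hvy : v = y
    · rw [hvy, sy]; exact (viewSign_bounds _ _ _).2
    exact (same v h1 h2 hvx hvy).le
  have strict : ∀ v, v = x ∨ v = y →
      viewSign a (insert x F) v < viewSign a (insert y F) v := by
    rintro v (rfl | rfl)
    · rw [sx, sx']; norm_num
    · rw [sy, sy']; norm_num
  set i := min |x - a| |y - a| with hi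
  have hi0 : 0 ≤ i := le_min (abs_nonneg _) (abs_nonneg _)
  have hix : i ≤ |x - a| := min_le_left _ _
  have hiy : i ≤ |y - a| := min_le_right _ _
  have e1 : ∀ j : ℚ, 0 ≤ j → |a - j - a| = j := fun j hj => by
    rw [show a - j - a = -j by ring, abs_neg, abs_of_nonneg hj]
  have e2 : ∀ j : ℚ, 0 ≤ j → |a + j - a| = j := fun j hj => by
    rw [show a + j - a = j by ring, abs_of_nonneg hj]
  have hends : (a - i = x ∨ a - i = y) ∨ (a + i = x ∨ a + i = y) := by
    rcases min_choice |x - a| |y - a| with h | h <;> rw [← hi] at h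
    · rcases abs_choice (x - a) with h' | h' <;> rw [h'] at h
      · right; left; linarith
      · left; left; linarith
    · rcases abs_choice (y - a) with h' | h' <;> rw [h'] at h
      · right; right; linarith
      · left; right; linarith
  refine ⟨i, fun j hj => ?_, ?_⟩
  · change (if j < 0 then (0 : ℤ) else _) = if j < 0 then (0 : ℤ) else _
    split_ifs with hj0
    · rfl
    · push Not at hj0
      have key : ∀ v, |v - a| = j →
          viewSign a (insert x F) v = viewSign a (insert y F) v := by
        intro v hv
        refine same v (by linarith) (by linarith) ?_ ?_
        · rintro rfl; linarith
        · rintro rfl; linarith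
      rw [key _ (e1 j hj0), key _ (e2 j hj0)]
  · change (if i < 0 then (0 : ℤ) else _) < if i < 0 then (0 : ℤ) else _
    rw [if_neg (not_lt.mpr hi0), if_neg (not_lt.mpr hi0)]
    have m1 := mono (a - i) (by rw [e1 i hi0]; exact hix) (by rw [e1 i hi0]; exact hiy)
    have m2 := mono (a + i) (by rw [e2 i hi0]; exact hix) (by rw [e2 i hi0]; exact hiy)
    rcases hends with h | h
    · exact add_lt_add_of_lt_of_le (strict _ h) m2
    · exact add_lt_add_of_le_of_lt m1 (strict _ h)

/-- A set of vertices that crosses no simplex of a nonempty triangulation is a face of it. -/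
theorem exists_mem_superset_of_not_cross {V : Finset ℚ} {n : ℕ} {T : Finset (Finset ℚ)}
    (hcard : ∀ S ∈ T, S ⊆ V ∧ S.card = n + 1)
    (hadj : ∀ S ∈ T, ∀ F ⊆ S, F.card = n →
      (∃ G, IsFacet V n G ∧ F ⊆ G) ∨ ∃ R ∈ T, R ≠ S ∧ F ⊆ R)
    (hcross : ∀ S ∈ T, ∀ R ∈ T, ¬Cross n S R) (hT : T.Nonempty) (A : Finset ℚ) (hAV : A ⊆ V)
    (hA : ∀ R ∈ T, ¬Cross n A R ∧ ¬Cross n R A) : ∃ S ∈ T, A ⊆ S := by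
  induction A using Finset.induction_on with
  | empty =>
    obtain ⟨S, hS⟩ := hT
    exact ⟨S, hS, by simp⟩
  | insert a A haA ih =>
    obtain ⟨S₀, hS₀, hAS₀⟩ := ih ((Finset.subset_insert _ _).trans hAV) fun R hR =>
      ⟨fun h => (hA R hR).1 (h.mono (Finset.subset_insert _ _) subset_rfl),
        fun h => (hA R hR).2 (h.mono subset_rfl (Finset.subset_insert _ _))⟩
    by_contra! hno
    have haS : ∀ S ∈ T, A ⊆ S → a ∉ S := fun S hS hAS ha =>
      hno S hS (Finset.insert_subset ha hAS)
    obtain ⟨S, hSM, hmax⟩ := (T.filter (A ⊆ ·)).exists_maximalFor (viewKey a)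
      ⟨S₀, by simp [hS₀, hAS₀]⟩
    obtain ⟨hS, hAS⟩ := Finset.mem_filter.mp hSM
    have ha := haS S hS hAS
    have hodd : ∀ x ∈ S, ¬Even (btw S a x) → x ∈ A := by
      intro x hxS hox
      by_contra hxA
      have hSF : insert x (S.erase x) = S := Finset.insert_erase hxS
      set F := S.erase x with hF
      have hxF : x ∉ F := Finset.notMem_erase _ _
      have haF : a ∉ F := fun h => ha (Finset.mem_of_mem_erase h)
      have hAF : A ⊆ F := Finset.subset_erase.mpr ⟨hAS, hxA⟩
      have hFc : F.card = n := by
        rw [hF, Finset.card_erase_of_mem hxS, (hcard S hS).2]; simp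
      rw [← hSF, btw_insert (not_between_of_abs_le le_rfl)] at hox
      have hox' := (not_congr (even_btw_iff haF hxF)).mp hox
      rcases hadj S hS F (Finset.erase_subset _ _) hFc with ⟨G, hG, hFG⟩ | ⟨R, hR, hRS, hFR⟩
      · have hGF : F = G := Finset.eq_of_subset_of_card_le hFG (by rw [hG.card_eq, hFc])
        subst hGF
        exact hox' (hG.even_up_iff (hAV (Finset.mem_insert_self _ _)) ((hcard S hS).1 hxS) haF hxF)
      · obtain ⟨y, hyR, hyF⟩ := Finset.exists_mem_notMem_of_card_lt_card
          (show F.card < R.card by rw [hFc, (hcard R hR).2]; omega)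
        have hRy : insert y F = R := Finset.eq_of_subset_of_card_le
          (Finset.insert_subset hyR hFR)
          (by rw [Finset.card_insert_of_notMem hyF, hFc, (hcard R hR).2])
        have hxy : x ≠ y := by
          rintro rfl
          exact hRS (hRy.symm.trans hSF)
        have hside : ¬(Even (up F x) ↔ Even (up F y)) := by
          intro h
          have hc := cross_of_same_side hFc hxF hyF hxy h
          rw [hSF, hRy] at hc
          exact hc.elim (hcross S hS R hR) (hcross R hR S hS)
        have hey : Even (btw F a y) := (even_btw_iff haF hyF).mpr (by tauto)
        have hlt := viewKey_lt hxF hyF hxy hox hey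
        rw [hSF, hRy] at hlt
        exact absurd (hmax (Finset.mem_filter.mpr ⟨hR, hAF.trans hFR⟩) hlt.le)
          (not_le_of_gt hlt)
    have hUc : (insert a S).card = n + 2 := by
      rw [Finset.card_insert_of_notMem ha, (hcard S hS).2]
    have hpar : ∀ z ∈ S, (Even (up (insert a S) a) ↔ Even (up (insert a S) z)) → z ∈ A := by
      intro z hz h
      apply hodd z hz
      have hza : a ≠ z := by rintro rfl; exact ha hz
      have haF : a ∉ S.erase z := fun h => ha (Finset.mem_of_mem_erase h)
      have := even_up_insert_insert haF (Finset.notMem_erase z S) hza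
      rw [Finset.insert_erase hz] at this
      rw [← Finset.insert_erase hz, btw_insert (not_between_of_abs_le le_rfl),
        even_btw_iff haF (Finset.notMem_erase z S)]
      exact this.mp h
    by_cases he : Even (up (insert a S) a)
    · refine (hA S hS).1 ⟨_, hUc, fun z hz => ?_⟩
      rcases Finset.mem_insert.mp hz with rfl | hz
      · exact ⟨by simp, fun h => absurd he h⟩
      · exact ⟨fun h => Finset.mem_insert_of_mem (hpar z hz (iff_of_true he h)), fun _ => hz⟩
    · refine (hA S hS).2 ⟨_, hUc, fun z hz => ?_⟩
      rcases Finset.mem_insert.mp hz with rfl | hz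
      · exact ⟨fun h => absurd h he, by simp⟩
      · exact ⟨fun _ => hz, fun h => Finset.mem_insert_of_mem (hpar z hz (iff_of_false he h))⟩

/-- The elements of `U` with an even number of elements above them. -/
noncomputable def evens (U : Finset ℚ) : Finset ℚ := U.filter fun z => Even (up U z)

/-- The elements of `U` with an odd number of elements above them. -/
noncomputable def odds (U : Finset ℚ) : Finset ℚ := U.filter fun z => ¬Even (up U z)

lemma altChain_cons {u : ℚ} {s t : List ℚ} (h : AltChain t s) (hu : ∀ b ∈ t, u < b) :
    AltChain (u :: s) t := by
  cases t with
  | nil => cases s with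
    | nil => simp [AltChain]
    | cons => simp [AltChain] at h
  | cons b bs =>
    rw [AltChain]
    exact ⟨hu b (by simp), h⟩

lemma up_insert_min {U : Finset ℚ} {u : ℚ} (h : ∀ x ∈ U, u < x) : up (insert u U) u = U.card := by
  rw [up_insert_of_le le_rfl, up, Finset.filter_true_of_mem h]

lemma evens_odds_insert {U : Finset ℚ} {u : ℚ} (h : ∀ x ∈ U, u < x) :
    evens (insert u U) = (if Even U.card then insert u (evens U) else evens U) ∧
    odds (insert u U) = if Even U.card then odds U else insert u (odds U) := by
  have hmin := up_insert_min h
  have hrest : ∀ z ∈ U, up (insert u U) z = up U z := fun z hz => up_insert_of_le (h z hz).le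
  constructor
  · unfold evens
    rw [Finset.filter_insert, hmin, Finset.filter_congr fun z hz => by rw [hrest z hz]]
  · unfold odds
    rw [Finset.filter_insert, hmin, Finset.filter_congr fun z hz => by rw [hrest z hz]]
    split_ifs <;> rfl

lemma altChain_evens_odds (U : Finset ℚ) :
    (if Even U.card then
      AltChain ((odds U).sort (· ≤ ·)) ((evens U).sort (· ≤ ·)) ∧ (evens U).card = (odds U).card
    else
      AltChain ((evens U).sort (· ≤ ·)) ((odds U).sort (· ≤ ·)) ∧
        (evens U).card = (odds U).card + 1) := by
  induction U using Finset.induction_on_min with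
  | empty => simp [evens, odds, AltChain]
  | insert u U hu ih =>
    have huU : u ∉ U := fun h => lt_irrefl _ (hu u h)
    have hue : ∀ b ∈ evens U, u < b := fun b hb => hu b (Finset.mem_filter.mp hb).1
    have huo : ∀ b ∈ odds U, u < b := fun b hb => hu b (Finset.mem_filter.mp hb).1
    have hue' : u ∉ evens U := fun h => lt_irrefl _ (hue u h)
    have huo' : u ∉ odds U := fun h => lt_irrefl _ (huo u h)
    obtain ⟨he, ho⟩ := evens_odds_insert hu
    rw [he, ho, Finset.card_insert_of_notMem huU]
    by_cases hc : Even U.card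
    · simp only [hc, if_true, Nat.even_add_one, not_true_eq_false, if_false] at ih ⊢
      rw [Finset.sort_insert _ (fun b hb => (hue b hb).le) hue',
        Finset.card_insert_of_notMem hue']
      exact ⟨altChain_cons ih.1 fun b hb => huo b (by simpa using hb), by rw [ih.2]⟩
    · simp only [hc, if_true, Nat.even_add_one, not_false_eq_true, if_false] at ih ⊢
      rw [Finset.sort_insert _ (fun b hb => (huo b hb).le) huo',
        Finset.card_insert_of_notMem huo']
      exact ⟨altChain_cons ih.1 fun b hb => hue b (by simpa using hb), ih.2⟩

lemma evens_union_odds (U : Finset ℚ) : (evens U).card + (odds U).card = U.card :=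
  Finset.card_filter_add_card_filter_not _

lemma wr_odds_evens {U : Finset ℚ} {d : ℕ} (hU : U.card = 2 * d + 2) :
    (evens U).card = d + 1 ∧ (odds U).card = d + 1 ∧ Wr (odds U) (evens U) := by
  have h := altChain_evens_odds U
  rw [if_pos (by rw [hU]; exact ⟨d + 1, by ring⟩)] at h
  have h' := evens_union_odds U
  refine ⟨by omega, by omega, ?_⟩
  rw [Wr, if_pos h.2.symm]
  exact h.1

lemma exists_up_succ {U : Finset ℚ} {u z : ℚ} (hz : z ∈ U) (h : u < z) :
    ∃ u' ∈ U, u < u' ∧ up U u = up U u' + 1 := by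
  have hne : (U.filter fun x => u < x).Nonempty := ⟨z, by simp [hz, h]⟩
  have hmem := Finset.mem_filter.mp (Finset.min'_mem _ hne)
  refine ⟨_, hmem.1, hmem.2, ?_⟩
  unfold up
  rw [← Finset.card_erase_add_one (Finset.min'_mem _ hne)]
  congr 2
  ext w
  simp only [Finset.mem_erase, Finset.mem_filter]
  constructor
  · rintro ⟨h1, h2, h3⟩
    exact ⟨h2, lt_of_le_of_ne (Finset.min'_le _ _ (by simp [h2, h3])) (Ne.symm h1)⟩
  · rintro ⟨h1, h2⟩
    exact ⟨h2.ne', h1, hmem.2.trans h2⟩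

lemma card_filter_ge_ge_up {U G : Finset ℚ} {τ : ℕ} (hτ : τ ≤ 1)
    (h : ∀ u ∈ U, u ∈ G ∨ (Even (up G u) ↔ Even (up U u + τ))) (k : ℕ) :
    ∀ u ∈ U, up U u = k → k + τ ≤ (G.filter fun x => u ≤ x).card := by
  have hle : ∀ u, up G u ≤ (G.filter fun x => u ≤ x).card := fun u =>
    Finset.card_le_card fun x hx => by
      simp only [Finset.mem_filter] at hx ⊢
      exact ⟨hx.1, hx.2.le⟩
  have hlt : ∀ u ∈ G, up G u + 1 ≤ (G.filter fun x => u ≤ x).card := fun u hu => by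
    rw [up, ← Finset.card_insert_of_notMem (show u ∉ G.filter fun x => u < x by simp)]
    refine Finset.card_le_card fun x hx => ?_
    simp only [Finset.mem_filter, Finset.mem_insert] at hx ⊢
    rcases hx with rfl | hx
    · exact ⟨hu, le_rfl⟩
    · exact ⟨hx.1, hx.2.le⟩
  have step : ∀ u ∈ U, up U u + τ ≤ up G u + 1 →
      up U u + τ ≤ (G.filter fun x => u ≤ x).card := by
    intro u hu hb
    rcases h u hu with hG | hp
    · exact hb.trans (hlt u hG)
    · have h1 := hle u
      simp only [Nat.even_iff] at hp
      omega
  induction k with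
  | zero =>
    intro u hu hk
    rw [← hk]
    exact step u hu (by omega)
  | succ k ih =>
    intro u hu hk
    have hne : (U.filter fun x => u < x).Nonempty := by
      rw [← Finset.card_pos]
      change 0 < up U u
      omega
    obtain ⟨z, hz⟩ := hne
    rw [Finset.mem_filter] at hz
    obtain ⟨u', hu', huu', hup⟩ := exists_up_succ hz.1 hz.2
    have h1 := ih u' hu' (by omega)
    have h2 : (G.filter fun x => u' ≤ x).card ≤ up G u := Finset.card_le_card fun x hx => by
      simp only [Finset.mem_filter] at hx ⊢
      exact ⟨hx.1, huu'.trans_le hx.2⟩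
    rw [← hk]
    exact step u hu (by omega)

lemma not_isFacet_of_parity {U V G : Finset ℚ} {n τ : ℕ} (hU : U.card = n + 2) (hτ : τ ≤ 1)
    (hG : IsFacet V n G) (h : ∀ u ∈ U, u ∈ G ∨ (Even (up G u) ↔ Even (up U u + τ))) : False := by
  have hne : U.Nonempty := by rw [← Finset.card_pos]; omega
  have hmin := Finset.min'_mem U hne
  have hup : up U (U.min' hne) = n + 1 := by
    rw [up, show (U.filter fun x => U.min' hne < x) = U.erase (U.min' hne) from ?_,
      Finset.card_erase_of_mem hmin, hU]
    · rfl
    · ext x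
      simp only [Finset.mem_filter, Finset.mem_erase]
      exact ⟨fun h => ⟨h.2.ne', h.1⟩,
        fun h => ⟨h.2, lt_of_le_of_ne (Finset.min'_le _ _ h.2) (Ne.symm h.1)⟩⟩
  have h1 := card_filter_ge_ge_up hτ h (n + 1) _ hmin hup
  have h2 := Finset.card_filter_le G fun x => U.min' hne ≤ x
  rw [hG.card_eq] at h2
  omega

lemma not_evens_subset_facet {U V G : Finset ℚ} {n : ℕ} (hU : U.card = n + 2) (hUV : U ⊆ V)
    (hG : IsFacet V n G) : ¬evens U ⊆ G := by
  intro hs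
  have hGc := hG
  rcases hG with hG | hG
  · refine not_isFacet_of_parity (τ := 0) hU (by omega) hGc fun u hu => ?_
    by_cases huG : u ∈ G
    · exact Or.inl huG
    · have h1 : Odd (up G u) := hG.2.2 u (by simp [hUV hu, huG])
      have h2 : ¬Even (up U u) := fun h => huG (hs (by simp [evens, hu, h]))
      exact Or.inr (iff_of_false (Nat.not_even_iff_odd.mpr h1) h2)
  · refine not_isFacet_of_parity (τ := 1) hU le_rfl hGc fun u hu => ?_
    by_cases huG : u ∈ G
    · exact Or.inl huG
    · have h1 : Even (up G u) := hG.2.2 u (by simp [hUV hu, huG])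
      have h2 : ¬Even (up U u) := fun h => huG (hs (by simp [evens, hu, h]))
      exact Or.inr (iff_of_true h1 (Nat.even_add_one.mpr h2))

lemma not_odds_subset_facet {U V G : Finset ℚ} {n : ℕ} (hU : U.card = n + 2) (hUV : U ⊆ V)
    (hG : IsFacet V n G) : ¬odds U ⊆ G := by
  intro hs
  have hGc := hG
  rcases hG with hG | hG
  · refine not_isFacet_of_parity (τ := 1) hU le_rfl hGc fun u hu => ?_
    by_cases huG : u ∈ G
    · exact Or.inl huG
    · have h1 : Odd (up G u) := hG.2.2 u (by simp [hUV hu, huG])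
      have h2 : Even (up U u) := by
        by_contra h
        exact huG (hs (Finset.mem_filter.mpr ⟨hu, h⟩))
      exact Or.inr (iff_of_false (Nat.not_even_iff_odd.mpr h1) fun h =>
        Nat.even_add_one.mp h h2)
  · refine not_isFacet_of_parity (τ := 0) hU (by omega) hGc fun u hu => ?_
    by_cases huG : u ∈ G
    · exact Or.inl huG
    · have h1 : Even (up G u) := hG.2.2 u (by simp [hUV hu, huG])
      have h2 : Even (up U u) := by
        by_contra h
        exact huG (hs (Finset.mem_filter.mpr ⟨hu, h⟩))
      exact Or.inr (iff_of_true h1 h2)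

lemma cross_iff {n : ℕ} {P Q : Finset ℚ} :
    Cross n P Q ↔ ∃ U : Finset ℚ, U.card = n + 2 ∧ evens U ⊆ P ∧ odds U ⊆ Q := by
  simp only [Cross, evens, odds, Finset.subset_iff, Finset.mem_filter]
  constructor
  · rintro ⟨U, hU, h⟩
    exact ⟨U, hU, fun z hz => (h z hz.1).1 hz.2, fun z hz => (h z hz.1).2 hz.2⟩
  · rintro ⟨U, hU, h1, h2⟩
    exact ⟨U, hU, fun z hz => ⟨fun e => h1 ⟨hz, e⟩, fun e => h2 ⟨hz, e⟩⟩⟩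

lemma subset_of_evens_odds {U V : Finset ℚ} (h1 : evens U ⊆ V) (h2 : odds U ⊆ V) : U ⊆ V := by
  intro z hz
  by_cases h : Even (up U z)
  · exact h1 (by simp [evens, hz, h])
  · exact h2 (Finset.mem_filter.mpr ⟨hz, h⟩)

lemma IsTriangulation.not_cross {V : Finset ℚ} {d : ℕ} {T : Finset (Finset ℚ)}
    (hT : IsTriangulation V (2 * d) T) : ∀ S ∈ T, ∀ R ∈ T, ¬Cross (2 * d) S R := by
  intro S hS R hR h
  obtain ⟨U, hU, he, ho⟩ := cross_iff.mp h
  obtain ⟨ce, co, hw⟩ := wr_odds_evens hU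
  refine hT.2.2 R hR S hS (odds U) (evens U) ⟨ho.trans (hT.1 R hR).1, he.trans (hT.1 S hS).1,
    Or.inl ⟨by omega, by omega, hw⟩⟩ ⟨ho, he⟩

lemma IsTriangulation.exists_superset {V : Finset ℚ} {d : ℕ} {T : Finset (Finset ℚ)}
    (hT : IsTriangulation V (2 * d) T) (hne : T.Nonempty) {A : Finset ℚ} (hAV : A ⊆ V)
    (hA : ∀ R ∈ T, ¬Cross (2 * d) A R ∧ ¬Cross (2 * d) R A) : ∃ S ∈ T, A ⊆ S :=
  exists_mem_superset_of_not_cross hT.1 hT.2.1 hT.not_cross hne A hAV hA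

lemma mem_internalSimps {V A : Finset ℚ} {d : ℕ} {T : Finset (Finset ℚ)} :
    A ∈ internalSimps V (2 * d) T ↔
      A ⊆ V ∧ A.card = d + 1 ∧ (∃ S ∈ T, A ⊆ S) ∧ ∀ F, IsFacet V (2 * d) F → ¬A ⊆ F := by
  simp [internalSimps]

lemma evens_mem_internalSimps {U V : Finset ℚ} {d : ℕ} {T : Finset (Finset ℚ)}
    (hU : U.card = 2 * d + 2) (hUV : U ⊆ V) (h : ∃ S ∈ T, evens U ⊆ S) :
    evens U ∈ internalSimps V (2 * d) T :=
  mem_internalSimps.mpr ⟨(Finset.filter_subset _ _).trans hUV, (wr_odds_evens hU).1, h,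
    fun _ hF => not_evens_subset_facet hU hUV hF⟩

lemma odds_mem_internalSimps {U V : Finset ℚ} {d : ℕ} {T : Finset (Finset ℚ)}
    (hU : U.card = 2 * d + 2) (hUV : U ⊆ V) (h : ∃ S ∈ T, odds U ⊆ S) :
    odds U ∈ internalSimps V (2 * d) T :=
  mem_internalSimps.mpr ⟨(Finset.filter_subset _ _).trans hUV, (wr_odds_evens hU).2.1, h,
    fun _ hF => not_odds_subset_facet hU hUV hF⟩

/-- A triangulation crossing no simplex of a nonempty triangulation is contained in it. -/
lemma IsTriangulation.subset_of_not_cross {V : Finset ℚ} {d : ℕ} {T T' : Finset (Finset ℚ)}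
    (hT : IsTriangulation V (2 * d) T) (hT' : IsTriangulation V (2 * d) T') (hne : T'.Nonempty)
    (h : ∀ S ∈ T, ∀ R ∈ T', ¬Cross (2 * d) S R ∧ ¬Cross (2 * d) R S) : T ⊆ T' := by
  intro S hS
  obtain ⟨R, hR, hSR⟩ := hT'.exists_superset hne (hT.1 S hS).1 (h S hS)
  rwa [Finset.eq_of_subset_of_card_le hSR (by rw [(hT.1 S hS).2, (hT'.1 R hR).2])]

lemma IsTriangulation.eq_of_internalSimps_subset {V : Finset ℚ} {d : ℕ}
    {T T' : Finset (Finset ℚ)} (hT : IsTriangulation V (2 * d) T)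
    (hT' : IsTriangulation V (2 * d) T') (hne : T.Nonempty) (hne' : T'.Nonempty)
    (h : internalSimps V (2 * d) T ⊆ internalSimps V (2 * d) T') : T = T' := by
  have key : ∀ S ∈ T, ∀ R ∈ T', ¬Cross (2 * d) S R ∧ ¬Cross (2 * d) R S := by
    intro S hS R hR
    constructor <;> intro hc <;> obtain ⟨U, hU, he, ho⟩ := cross_iff.mp hc
    · have hUV := subset_of_evens_odds (he.trans (hT.1 S hS).1) (ho.trans (hT'.1 R hR).1)
      obtain ⟨-, -, ⟨Q, hQ, hQs⟩, -⟩ :=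
        mem_internalSimps.mp (h (evens_mem_internalSimps hU hUV ⟨S, hS, he⟩))
      exact hT'.not_cross Q hQ R hR (cross_iff.mpr ⟨U, hU, hQs, ho⟩)
    · have hUV := subset_of_evens_odds (he.trans (hT'.1 R hR).1) (ho.trans (hT.1 S hS).1)
      obtain ⟨-, -, ⟨Q, hQ, hQs⟩, -⟩ :=
        mem_internalSimps.mp (h (odds_mem_internalSimps hU hUV ⟨S, hS, ho⟩))
      exact hT'.not_cross R hR Q hQ (cross_iff.mpr ⟨U, hU, he, hQs⟩)
  exact (hT.subset_of_not_cross hT' hne' key).antisymm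
    (hT'.subset_of_not_cross hT hne fun R hR S hS => (key S hS R hR).symm)

/-- A face avoiding `v` and contained in no facet lies in a simplex avoiding `v`. -/
lemma IsTriangulation.exists_superset_notMem {V : Finset ℚ} {n : ℕ} {T : Finset (Finset ℚ)}
    (hT : IsTriangulation V n T) {A S : Finset ℚ} {v : ℚ} (hS : S ∈ T) (hAS : A ⊆ S) (hv : v ∉ A)
    (hA : ∀ F, IsFacet V n F → ¬A ⊆ F) : ∃ R ∈ T, A ⊆ R ∧ v ∉ R := by
  by_cases hvS : v ∈ S
  · have hAF : A ⊆ S.erase v := Finset.subset_erase.mpr ⟨hAS, hv⟩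
    rcases hT.2.1 S hS (S.erase v) (Finset.erase_subset _ _)
      (by rw [Finset.card_erase_of_mem hvS, (hT.1 S hS).2]; simp) with ⟨G, hG, hFG⟩ | ⟨R, hR, h, hF⟩
    · exact absurd (hAF.trans hFG) (hA G hG)
    · refine ⟨R, hR, hAF.trans hF, fun hvR => h (Eq.symm ?_)⟩
      refine Finset.eq_of_subset_of_card_le ?_ (by rw [(hT.1 S hS).2, (hT.1 R hR).2])
      rw [← Finset.insert_erase hvS]
      exact Finset.insert_subset hvR hF
  · exact ⟨S, hS, hAS, hvS⟩

/-- Simplices on which the vertex map `c` is injective survive the contraction along `c`. -/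
lemma exists_image_eq_of_contractTri_eq {c : ℚ → ℚ} {n : ℕ} {T T' : Finset (Finset ℚ)}
    (h : contractTri c n T = contractTri c n T') {S : Finset ℚ} (hS : S ∈ T)
    (hc : S.card = n + 1) (hinj : Set.InjOn c S) : ∃ R ∈ T', R.image c = S.image c := by
  have hmem : S.image c ∈ contractTri c n T := by
    simp only [contractTri, Finset.mem_filter, Finset.mem_image]
    exact ⟨⟨S, hS, rfl⟩, by rw [Finset.card_image_of_injOn hinj, hc]⟩
  rw [h] at hmem
  simp only [contractTri, Finset.mem_filter, Finset.mem_image] at hmem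
  exact hmem.1

lemma botMap_injOn {S : Finset ℚ} (h : (1 : ℚ) ∉ S ∨ (2 : ℚ) ∉ S) : Set.InjOn botMap S := by
  intro x hx y hy hxy
  simp only [Finset.mem_coe] at hx hy
  unfold botMap at hxy
  split_ifs at hxy with h1 h2 h2
  · rw [h1, h2]
  · subst h1 hxy; tauto
  · subst h2 hxy; tauto
  · exact hxy

lemma topMap_injOn {S : Finset ℚ} {m : ℚ} (h : m ∉ S) : Set.InjOn (topMap m) S := by
  intro x hx y hy hxy
  simp only [Finset.mem_coe] at hx hy
  have h1 : x ≠ m := by rintro rfl; exact h hx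
  have h2 : y ≠ m := by rintro rfl; exact h hy
  simpa [topMap, h1, h2] using hxy

lemma mem_vSet {m : ℕ} {v : ℚ} : v ∈ vSet m ↔ ∃ i : ℕ, (1 ≤ i ∧ i ≤ m) ∧ (i : ℚ) = v := by
  simp [vSet]

lemma one_le_of_mem_vSet {m : ℕ} {v : ℚ} (h : v ∈ vSet m) : 1 ≤ v := by
  obtain ⟨i, hi, rfl⟩ := mem_vSet.mp h
  exact_mod_cast hi.1

lemma le_of_mem_vSet {m : ℕ} {v : ℚ} (h : v ∈ vSet m) : v ≤ m := by
  obtain ⟨i, hi, rfl⟩ := mem_vSet.mp h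
  exact_mod_cast hi.2

lemma two_le_of_mem_vSet {m : ℕ} {v : ℚ} (h : v ∈ vSet m) (h1 : v ≠ 1) : 2 ≤ v := by
  obtain ⟨i, hi, rfl⟩ := mem_vSet.mp h
  have : i ≠ 1 := by rintro rfl; simp at h1
  have : 2 ≤ i := by omega
  exact_mod_cast this

lemma le_sub_one_of_mem_vSet {m : ℕ} {v : ℚ} (h : v ∈ vSet m) (h1 : v ≠ m) : v ≤ m - 1 := by
  obtain ⟨i, hi, rfl⟩ := mem_vSet.mp h
  have : i ≠ m := by rintro rfl; simp at h1
  have : i + 1 ≤ m := by omega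
  have : (i : ℚ) + 1 ≤ m := by exact_mod_cast this
  linarith

lemma card_vSet (m : ℕ) : (vSet m).card = m := by
  have h : vSet m = (Finset.Icc 1 m).image (Nat.cast : ℕ → ℚ) := by
    ext v
    simp [mem_vSet]
  rw [h, Finset.card_image_of_injective _ Nat.cast_injective]
  simp

lemma up_of_min {U : Finset ℚ} {u : ℚ} (hu : u ∈ U) (h : ∀ z ∈ U, u ≤ z) :
    up U u = U.card - 1 := by
  have h' := up_insert_min (U := U.erase u) (u := u) fun x hx =>
    lt_of_le_of_ne (h x (Finset.mem_of_mem_erase hx)) (Ne.symm (Finset.ne_of_mem_erase hx))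
  rwa [Finset.insert_erase hu, Finset.card_erase_of_mem hu] at h'

lemma up_of_max {U : Finset ℚ} {u : ℚ} (h : ∀ z ∈ U, z ≤ u) : up U u = 0 := by
  rw [up, Finset.card_eq_zero, Finset.filter_eq_empty_iff]
  exact fun x hx => not_lt.mpr (h x hx)

/-- Some simplex of a nonempty triangulation does not contain both `1` and `2`. -/
lemma IsTriangulation.exists_not_one_two {m d : ℕ} (hd : 1 ≤ d) (hm : 2 * d + 2 ≤ m)
    {T : Finset (Finset ℚ)} (hT : IsTriangulation (vSet m) (2 * d) T) (hne : T.Nonempty) :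
    ∃ S ∈ T, (1 : ℚ) ∉ S ∨ (2 : ℚ) ∉ S := by
  by_contra! hall
  obtain ⟨S, hS⟩ := hne
  obtain ⟨h1, h2⟩ := hall S hS
  have hfacet : ∀ v ∈ S, v = 1 ∨ v = 2 → IsFacet (vSet m) (2 * d) (S.erase v) := by
    intro v hv hv12
    by_contra hno
    have hc : (S.erase v).card = 2 * d := by
      rw [Finset.card_erase_of_mem hv, (hT.1 S hS).2]; simp
    obtain ⟨R, hR, -, hvR⟩ := hT.exists_superset_notMem hS (Finset.erase_subset v S)
      (Finset.notMem_erase v S) fun F hF hsub => hno (by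
        rwa [Finset.eq_of_subset_of_card_le hsub (by rw [hF.card_eq, hc])])
    rcases hv12 with rfl | rfl
    · exact hvR (hall R hR).1
    · exact hvR (hall R hR).2
  have hSV := (hT.1 S hS).1
  have hSc := (hT.1 S hS).2
  obtain ⟨w, hwV, hwS⟩ := Finset.exists_mem_notMem_of_card_lt_card
    (show S.card < (vSet m).card by rw [card_vSet, hSc]; omega)
  have hw1 : w ≠ 1 := by rintro rfl; exact hwS h1
  have hw2 : w ≠ 2 := by rintro rfl; exact hwS h2
  have hw : 2 < w := lt_of_le_of_ne (two_le_of_mem_vSet hwV hw1) (Ne.symm hw2)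
  have p1 := (hfacet 1 h1 (Or.inl rfl)).even_up_iff (hSV h1) hwV (Finset.notMem_erase _ _)
    fun h => hwS (Finset.mem_of_mem_erase h)
  have p2 := (hfacet 2 h2 (Or.inr rfl)).even_up_iff (hSV h2) hwV (Finset.notMem_erase _ _)
    fun h => hwS (Finset.mem_of_mem_erase h)
  have e : ∀ v ≤ w, v ∈ S → up (S.erase v) w = up S w := fun v hv hvS => by
    conv_rhs => rw [← Finset.insert_erase hvS, up_insert_of_le hv]
  rw [e 1 (by linarith) h1] at p1
  rw [e 2 hw.le h2] at p2
  have u1 : up (S.erase 1) 1 = 2 * d := by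
    have := up_of_min h1 fun z hz => one_le_of_mem_vSet (hSV hz)
    rw [← Finset.insert_erase h1, up_insert_of_le le_rfl, Finset.insert_erase h1, hSc] at this
    simpa using this
  have h21 : (2 : ℚ) ∈ S.erase 1 := Finset.mem_erase.mpr ⟨by norm_num, h2⟩
  have u2 : up (S.erase 2) 2 = 2 * d - 1 := by
    have := up_of_min h21 fun z hz =>
      two_le_of_mem_vSet (hSV (Finset.mem_of_mem_erase hz)) (Finset.ne_of_mem_erase hz)
    rw [Finset.card_erase_of_mem h1, hSc] at this
    have e1 : up (S.erase 1) 2 = up S 2 := by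
      conv_rhs => rw [← Finset.insert_erase h1, up_insert_of_le (by norm_num)]
    have e2 : up (S.erase 2) 2 = up S 2 := by
      conv_rhs => rw [← Finset.insert_erase h2, up_insert_of_le le_rfl]
    rw [e2, ← e1, this]
    rfl
  rw [u1] at p1
  rw [u2] at p2
  simp only [Nat.even_iff] at p1 p2
  omega

lemma nonempty_of_contractTri_eq {m d : ℕ} (hd : 1 ≤ d) (hm : 2 * d + 2 ≤ m)
    {T T' : Finset (Finset ℚ)} (hT : IsTriangulation (vSet m) (2 * d) T) (hne : T.Nonempty)
    (hbot : contractTri botMap (2 * d) T = contractTri botMap (2 * d) T') : T'.Nonempty := by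
  obtain ⟨S, hS, h⟩ := hT.exists_not_one_two hd hm hne
  obtain ⟨R, hR, -⟩ := exists_image_eq_of_contractTri_eq hbot hS (hT.1 S hS).2 (botMap_injOn h)
  exact ⟨R, hR⟩

lemma endpoints_of_cross {m d : ℕ} {T T' : Finset (Finset ℚ)}
    (hT : IsTriangulation (vSet m) (2 * d) T) (hT' : IsTriangulation (vSet m) (2 * d) T')
    (hbot : contractTri botMap (2 * d) T = contractTri botMap (2 * d) T')
    (htop : contractTri (topMap (m : ℚ)) (2 * d) T = contractTri (topMap (m : ℚ)) (2 * d) T')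
    {U S R : Finset ℚ} (hU : U.card = 2 * d + 2) (hS : S ∈ T) (hR : R ∈ T')
    (ho : odds U ⊆ S) (he : evens U ⊆ R) :
    ((1 : ℚ) ∈ odds U ∧ (m : ℚ) - 1 ∈ odds U ∧ (m : ℚ) ∉ odds U) ∧
      (2 : ℚ) ∈ evens U ∧ (1 : ℚ) ∉ evens U ∧ (m : ℚ) ∈ evens U := by
  have hUV := subset_of_evens_odds (he.trans (hT'.1 R hR).1) (ho.trans (hT.1 S hS).1)
  have hmin : ∀ u ∈ U, (∀ z ∈ U, u ≤ z) → ¬Even (up U u) := by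
    intro u hu h
    rw [up_of_min hu h, hU, Nat.even_iff]
    omega
  have hmax : ∀ u, (∀ z ∈ U, z ≤ u) → Even (up U u) := fun u h => by
    rw [up_of_max h]; exact Even.zero
  have h1e : (1 : ℚ) ∉ evens U := fun h => by
    obtain ⟨hu, h⟩ := Finset.mem_filter.mp h
    exact hmin 1 hu (fun z hz => one_le_of_mem_vSet (hUV hz)) h
  have hmo : (m : ℚ) ∉ odds U := fun h => by
    obtain ⟨hu, h⟩ := Finset.mem_filter.mp h
    exact h (hmax m fun z hz => le_of_mem_vSet (hUV hz))
  have h2e : (2 : ℚ) ∈ evens U := by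
    by_contra h2
    obtain ⟨R₁, hR₁, heR₁, hR1⟩ := hT'.exists_superset_notMem hR he h1e
      fun F hF => not_evens_subset_facet hU hUV hF
    obtain ⟨Q, hQ, hQR⟩ := exists_image_eq_of_contractTri_eq hbot.symm hR₁ (hT'.1 R₁ hR₁).2
      (botMap_injOn (Or.inl hR1))
    refine hT.not_cross Q hQ S hS (cross_iff.mpr ⟨U, hU, fun b hb => ?_, ho⟩)
    have hb1 : b ≠ 1 := by rintro rfl; exact h1e hb
    have hb2 : b ≠ 2 := by rintro rfl; exact h2 hb
    have hbR : b ∈ R₁.image botMap :=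
      Finset.mem_image.mpr ⟨b, heR₁ hb, by simp [botMap, hb1]⟩
    rw [← hQR] at hbR
    obtain ⟨r, hr, hrb⟩ := Finset.mem_image.mp hbR
    unfold botMap at hrb
    split_ifs at hrb
    · exact absurd hrb.symm hb2
    · rwa [← hrb]
  have hmo' : (m : ℚ) - 1 ∈ odds U := by
    by_contra hm1
    obtain ⟨S₁, hS₁, hoS₁, hSm⟩ := hT.exists_superset_notMem hS ho hmo
      fun F hF => not_odds_subset_facet hU hUV hF
    obtain ⟨Q, hQ, hQS⟩ := exists_image_eq_of_contractTri_eq htop hS₁ (hT.1 S₁ hS₁).2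
      (topMap_injOn hSm)
    refine hT'.not_cross R hR Q hQ (cross_iff.mpr ⟨U, hU, he, fun b hb => ?_⟩)
    have hb1 : b ≠ m := by rintro rfl; exact hmo hb
    have hb2 : b ≠ m - 1 := by rintro rfl; exact hm1 hb
    have hbS : b ∈ S₁.image (topMap m) :=
      Finset.mem_image.mpr ⟨b, hoS₁ hb, by simp [topMap, hb1]⟩
    rw [← hQS] at hbS
    obtain ⟨r, hr, hrb⟩ := Finset.mem_image.mp hbS
    unfold topMap at hrb
    split_ifs at hrb
    · exact absurd hrb.symm hb2
    · rwa [← hrb]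
  have h1U : (1 : ℚ) ∈ U := by
    by_contra h1
    obtain ⟨hu, h⟩ := Finset.mem_filter.mp h2e
    refine hmin 2 hu (fun z hz => two_le_of_mem_vSet (hUV hz) ?_) h
    rintro rfl
    exact h1 hz
  have hmU : (m : ℚ) ∈ U := by
    by_contra h1
    obtain ⟨hu, h⟩ := Finset.mem_filter.mp hmo'
    refine h (hmax _ fun z hz => le_sub_one_of_mem_vSet (hUV hz) ?_)
    rintro rfl
    exact h1 hz
  refine ⟨⟨Finset.mem_filter.mpr ⟨h1U, hmin 1 h1U fun z hz => one_le_of_mem_vSet (hUV hz)⟩,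
    hmo', hmo⟩, h2e, h1e,
    Finset.mem_filter.mpr ⟨hmU, hmax m fun z hz => le_of_mem_vSet (hUV hz)⟩⟩

/-- An internal `d`-simplex that is not a face of `T` crosses a simplex of `T`. -/
lemma IsTriangulation.exists_cross {V A : Finset ℚ} {d : ℕ} {T T₀ : Finset (Finset ℚ)}
    (hT : IsTriangulation V (2 * d) T) (hne : T.Nonempty) (hA : A ∈ internalSimps V (2 * d) T₀)
    (hA' : A ∉ internalSimps V (2 * d) T) :
    ∃ U : Finset ℚ, U.card = 2 * d + 2 ∧ U ⊆ V ∧ ∃ R ∈ T,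
      (evens U = A ∧ odds U ⊆ R) ∨ (odds U = A ∧ evens U ⊆ R) := by
  obtain ⟨hAV, hAc, -, hAF⟩ := mem_internalSimps.mp hA
  by_contra! hno
  refine hA' (mem_internalSimps.mpr ⟨hAV, hAc, hT.exists_superset hne hAV fun R hR => ?_, hAF⟩)
  constructor <;> intro hc <;> obtain ⟨U, hU, he, ho⟩ := cross_iff.mp hc
  · refine (hno U hU (subset_of_evens_odds (he.trans hAV) (ho.trans (hT.1 R hR).1)) R hR).1 ?_ ho
    exact Finset.eq_of_subset_of_card_le he (by rw [hAc, (wr_odds_evens hU).1])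
  · refine (hno U hU (subset_of_evens_odds (he.trans (hT.1 R hR).1) (ho.trans hAV)) R hR).2 ?_ he
    exact Finset.eq_of_subset_of_card_le ho (by rw [hAc, (wr_odds_evens hU).2.1])

/-- **Lemma.** If `T <₂ T'` but the contractions of `T` and `T'` at both ends agree, then
the internal `d`-simplices where `T` and `T'` differ have prescribed endpoints. -/
theorem even_contraction_vertices (m d : ℕ) (hd : 1 ≤ d) (hm : 2 * d + 2 ≤ m)
    (T T' : Finset (Finset ℚ))
    (hT : IsTriangulation (vSet m) (2 * d) T)
    (hT' : IsTriangulation (vSet m) (2 * d) T')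
    (hle : Le2Even (vSet m) d T T') (hne : T ≠ T')
    (hbot : contractTri botMap (2 * d) T = contractTri botMap (2 * d) T')
    (htop : contractTri (topMap (m : ℚ)) (2 * d) T = contractTri (topMap (m : ℚ)) (2 * d) T') :
    (∃ A, A ∈ internalSimps (vSet m) (2 * d) T ∧ A ∉ internalSimps (vSet m) (2 * d) T') ∧
    (∀ A ∈ internalSimps (vSet m) (2 * d) T, A ∉ internalSimps (vSet m) (2 * d) T' →
      (1 : ℚ) ∈ A ∧ ((m : ℚ) - 1) ∈ A ∧ (m : ℚ) ∉ A) ∧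
    (∃ B, B ∈ internalSimps (vSet m) (2 * d) T' ∧ B ∉ internalSimps (vSet m) (2 * d) T) ∧
    (∀ B ∈ internalSimps (vSet m) (2 * d) T', B ∉ internalSimps (vSet m) (2 * d) T →
      (2 : ℚ) ∈ B ∧ (1 : ℚ) ∉ B ∧ (m : ℚ) ∈ B) := by
  have hTne : T.Nonempty := by
    by_contra h
    rw [Finset.not_nonempty_iff_eq_empty] at h
    rcases T'.eq_empty_or_nonempty with h' | h'
    · exact hne (h.trans h'.symm)
    · exact (nonempty_of_contractTri_eq hd hm hT' h' hbot.symm).ne_empty h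
  have hTne' : T'.Nonempty := nonempty_of_contractTri_eq hd hm hT hTne hbot
  refine ⟨?_, fun A hA hA' => ?_, ?_, fun B hB hB' => ?_⟩
  · by_contra! h
    exact hne (hT.eq_of_internalSimps_subset hT' hTne hTne' h)
  · obtain ⟨U, hU, hUV, R, hR, ⟨rfl, ho⟩ | ⟨rfl, he⟩⟩ := hT'.exists_cross hTne' hA hA'
    · exact absurd (wr_odds_evens hU).2.2 (hle _ hA _ (odds_mem_internalSimps hU hUV ⟨R, hR, ho⟩))
    · obtain ⟨-, -, ⟨S, hS, ho⟩, -⟩ := mem_internalSimps.mp hA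
      exact (endpoints_of_cross hT hT' hbot htop hU hS hR ho he).1
  · by_contra! h
    exact hne (hT'.eq_of_internalSimps_subset hT hTne' hTne h).symm
  · obtain ⟨U, hU, hUV, S, hS, ⟨rfl, ho⟩ | ⟨rfl, he⟩⟩ := hT.exists_cross hTne hB hB'
    · obtain ⟨-, -, ⟨R, hR, he⟩, -⟩ := mem_internalSimps.mp hB
      exact (endpoints_of_cross hT hT' hbot htop hU hS hR ho he).2
    · exact absurd (wr_odds_evens hU).2.2 (hle _ (evens_mem_internalSimps hU hUV ⟨S, hS, he⟩) _ hB)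

end HST
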